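/- arXiv:2508.14238 — 2 statements merged into one kernel-verified Lean document; each statement's English description precedes it below -/
import Mathlib

section
/- Let T₁ and T₂ be trees on the same number of vertices with the same degree sequence. Then S_k(T₁) = S_k(T₂) for every k ∈ {0, 1, 2, 3, 4, 5}, and S₆(T₁) − S₆(T₂) = 6·(φ_{T₁}(P₄) − φ_{T₂}(P₄)), where φ_T(P₄) denotes the number of subgraphs of T isomorphic to the path P₄ on 4 vertices. -/
/-- The degree of a vertex (classical version, no decidability assumptions). -/
noncomputable def deg {V : Type*} [Fintype V] (G : SimpleGraph V) (v : V) : ℕ := by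
  classical exact G.degree v

/-- The `k`-th spectral moment of a graph: the trace of the `k`-th power of its
adjacency matrix, i.e. the number of closed walks of length `k`. -/
noncomputable def specMoment {V : Type*} [Fintype V] (G : SimpleGraph V) (k : ℕ) : ℤ := by
  classical exact Matrix.trace ((G.adjMatrix ℤ) ^ k)

/-- The number of subgraphs of `G` isomorphic to the path `P₄` on 4 vertices: each such
subgraph corresponds to exactly two ordered 4-tuples of distinct vertices forming a
path, whence the division by 2. -/
noncomputable def countP4 {V : Type*} [Fintype V] (G : SimpleGraph V) : ℕ := by
  classical
  exact (Finset.univ.filter (fun q : V × V × V × V =>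
    [q.1, q.2.1, q.2.2.1, q.2.2.2].Nodup ∧
      G.Adj q.1 q.2.1 ∧ G.Adj q.2.1 q.2.2.1 ∧ G.Adj q.2.2.1 q.2.2.2)).card / 2

namespace SimpleGraph

open Finset Matrix

variable {V : Type*} {G : SimpleGraph V}

/-- `a, b, c, d` are the consecutive vertices of a path on four vertices in `G`. -/
def IsPathFour (G : SimpleGraph V) (a b c d : V) : Prop :=
  [a, b, c, d].Nodup ∧ G.Adj a b ∧ G.Adj b c ∧ G.Adj c d

theorem IsPathFour.reverse {a b c d : V} (h : G.IsPathFour a b c d) : G.IsPathFour d c b a := by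
  obtain ⟨hn, hab, hbc, hcd⟩ := h
  exact ⟨by simpa using List.nodup_reverse.2 hn, hcd.symm, hbc.symm, hab.symm⟩

namespace IsAcyclic

theorem support_eq (hG : G.IsAcyclic) {u v : V} {p q : G.Walk u v}
    (hp : p.IsPath) (hq : q.IsPath) :
    p.support = q.support := by
  have h := congrArg Subtype.val ((hG.subsingleton_path u v).elim ⟨p, hp⟩ ⟨q, hq⟩)
  exact congrArg Walk.support h

theorem eq_of_adj_of_adj (hG : G.IsAcyclic) {a b b' c : V} (hac : a ≠ c)
    (hab : G.Adj a b) (hbc : G.Adj b c)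
    (hab' : G.Adj a b') (hbc' : G.Adj b' c) : b = b' := by
  have h := hG.support_eq (p := .cons hab (.cons hbc .nil)) (q := .cons hab' (.cons hbc' .nil))
    (by simp [Walk.isPath_def, hac, hab.ne, hbc.ne])
    (by simp [Walk.isPath_def, hac, hab'.ne, hbc'.ne])
  simpa using h

theorem not_adj_of_adj_of_adj (hG : G.IsAcyclic) {a b c : V} (hab : G.Adj a b) (hbc : G.Adj b c) :
    ¬ G.Adj c a := by
  intro hca
  have h := hG.support_eq (p := .cons hab (.cons hbc .nil)) (q := .cons hca.symm .nil)
    (by simp [Walk.isPath_def, hca.ne', hab.ne, hbc.ne]) (by simp [Walk.isPath_def, hca.ne'])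
  simp at h

theorem isPathFour_unique (hG : G.IsAcyclic) {a b c b' c' d : V} (h : G.IsPathFour a b c d)
    (h' : G.IsPathFour a b' c' d) : b = b' ∧ c = c' := by
  obtain ⟨hn, hab, hbc, hcd⟩ := h
  obtain ⟨hn', hab', hbc', hcd'⟩ := h'
  have h := hG.support_eq (p := .cons hab (.cons hbc (.cons hcd .nil)))
    (q := .cons hab' (.cons hbc' (.cons hcd' .nil)))
    (by simpa [Walk.isPath_def] using hn) (by simpa [Walk.isPath_def] using hn')
  simpa using h

theorem not_adj_of_isPathFour (hG : G.IsAcyclic) {a b c d : V} (h : G.IsPathFour a b c d) :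
    ¬ G.Adj a d := by
  intro had
  obtain ⟨hn, hab, hbc, hcd⟩ := h
  have h := hG.support_eq (p := .cons hab (.cons hbc (.cons hcd .nil))) (q := .cons had .nil)
    (by simpa [Walk.isPath_def] using hn) (by simp [Walk.isPath_def, had.ne])
  simp at h

end IsAcyclic

section Count

variable [Fintype V]

variable (G) in
open Classical in
/-- The number of paths on four vertices from `a` to `d`. -/
noncomputable def numPathFour (a d : V) : ℕ :=
  #{q : V × V | G.IsPathFour a q.1 q.2 d}

theorem IsAcyclic.numPathFour_le_one (hG : G.IsAcyclic) (a d : V) : G.numPathFour a d ≤ 1 := by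
  refine card_le_one.2 fun q hq q' hq' => ?_
  simp only [mem_filter, mem_univ, true_and] at hq hq'
  exact Prod.ext_iff.2 (hG.isPathFour_unique hq hq')

theorem IsAcyclic.numPathFour_eq_zero_of_adj (hG : G.IsAcyclic) {a d : V} (h : G.Adj a d) :
    G.numPathFour a d = 0 := by
  simp only [numPathFour, card_eq_zero, filter_eq_empty_iff]
  exact fun q _ hq => hG.not_adj_of_isPathFour hq h

open Classical in
theorem natCast_numPathFour (a d : V) :
    (G.numPathFour a d : ℤ) = ∑ b, ∑ c, if G.IsPathFour a b c d then 1 else 0 := by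
  rw [numPathFour, card_filter, Fintype.sum_prod_type]
  push_cast
  rfl

open Classical in
theorem even_card_isPathFour :
    Even #{q : V × V × V × V | G.IsPathFour q.1 q.2.1 q.2.2.1 q.2.2.2} := by
  rw [← ZMod.natCast_eq_zero_iff_even, cast_card]
  refine sum_involution (fun q _ => (q.2.2.2, q.2.2.1, q.2.1, q.1)) ?_ ?_ ?_ ?_
  · exact fun _ _ => CharTwo.add_self_eq_zero 1
  · rintro ⟨a, b, c, d⟩ hq - heq
    simp only [mem_filter, mem_univ, true_and, Prod.mk.injEq] at hq heq
    simp [IsPathFour, heq.1] at hq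
  · rintro ⟨a, b, c, d⟩ hq
    simp only [mem_filter, mem_univ, true_and] at hq ⊢
    exact hq.reverse
  · exact fun _ _ => rfl

theorem two_mul_countP4 :
    2 * (countP4 G : ℤ) = ∑ a, ∑ d, (G.numPathFour a d : ℤ) := by
  classical
  have hc : 2 * countP4 G = #{q : V × V × V × V | G.IsPathFour q.1 q.2.1 q.2.2.1 q.2.2.2} := by
    rw [← Nat.two_mul_div_two_of_even even_card_isPathFour]
    unfold countP4
    congr 3
    ext q
    rw [mem_filter, mem_filter]
    rfl
  rw [← Nat.cast_two, ← Nat.cast_mul, hc, card_filter]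
  simp only [natCast_numPathFour, Fintype.sum_prod_type, Nat.cast_sum, Nat.cast_ite,
    Nat.cast_one, Nat.cast_zero]
  refine sum_congr rfl fun a _ => ?_
  rw [sum_comm (f := fun d b => ∑ c, if G.IsPathFour a b c d then (1 : ℤ) else 0)]
  exact sum_congr rfl fun b _ => sum_comm

end Count

section Moments

variable [DecidableRel G.Adj]

variable (G) in
theorem adjMatrix_comm (v w : V) : G.adjMatrix ℤ v w = G.adjMatrix ℤ w v := by
  simp [adjMatrix_apply, G.adj_comm]

open Classical in
theorem IsAcyclic.adjMatrix_mul_mul [DecidableEq V] (hG : G.IsAcyclic) (a b c d : V) :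
    G.adjMatrix ℤ a b * (G.adjMatrix ℤ b c * G.adjMatrix ℤ c d) =
      (if G.IsPathFour a b c d then 1 else 0) +
      (if c = a then G.adjMatrix ℤ a b * G.adjMatrix ℤ a d else 0) +
      (if b = d then G.adjMatrix ℤ a d * G.adjMatrix ℤ d c else 0) -
      (if b = d then if c = a then G.adjMatrix ℤ a d else 0 else 0) := by
  have htri := @hG.not_adj_of_adj_of_adj
  by_cases hca : c = a
  · subst hca
    by_cases hbd : b = d
    · subst hbd
      by_cases h : G.Adj c b <;> simp [IsPathFour, h, G.adj_comm b c]
    · by_cases h : G.Adj c b <;> simp [IsPathFour, hbd, h, G.adj_comm b c]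
  · by_cases hbd : b = d
    · subst hbd
      by_cases h : G.Adj b c <;> simp [IsPathFour, hca, h, G.adj_comm c b]
    · have hp : G.IsPathFour a b c d ↔ G.Adj a b ∧ G.Adj b c ∧ G.Adj c d := by
        refine ⟨fun h => h.2, fun h => ⟨?_, h⟩⟩
        obtain ⟨hab, hbc, hcd⟩ := h
        have had : a ≠ d := by
          rintro rfl
          exact htri hab hbc hcd
        simp [hab.ne, hbc.ne, hcd.ne, had, hbd, Ne.symm hca]
      simp only [hp, hca, hbd, adjMatrix_apply]
      split_ifs <;> simp_all

variable [Fintype V]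

variable (G) in
theorem sum_adjMatrix (v : V) : ∑ w, G.adjMatrix ℤ v w = G.degree v := by
  simp [adjMatrix_apply, ← card_neighborFinset_eq_degree, neighborFinset_eq_filter]

variable (G) in
theorem sum_sum_adjMatrix_mul (f : V → ℤ) :
    ∑ u, ∑ v, G.adjMatrix ℤ u v * f u = ∑ u, G.degree u * f u := by
  simp only [← sum_mul, sum_adjMatrix]

variable (G) in
theorem sum_sum_adjMatrix_mul' (f : V → ℤ) :
    ∑ u, ∑ v, G.adjMatrix ℤ u v * f v = ∑ u, G.degree u * f u := by
  rw [sum_comm, ← sum_sum_adjMatrix_mul]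
  simp only [G.adjMatrix_comm]

variable [DecidableEq V]

theorem IsAcyclic.trace_adjMatrix_pow_of_odd (hG : G.IsAcyclic) {k : ℕ} (hk : Odd k) :
    trace (G.adjMatrix ℤ ^ k) = 0 := by
  refine sum_eq_zero fun v _ => ?_
  rw [diag_apply, adjMatrix_pow_apply_eq_card_walk, Nat.cast_eq_zero, Fintype.card_eq_zero_iff]
  refine ⟨fun p => Nat.not_even_iff_odd.2 hk ?_⟩
  have h := two_colorable_iff_forall_loop_even.1 hG.colorable_two v p.1
  rwa [show p.1.length = k from p.2] at h

variable (G) in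
theorem trace_adjMatrix_pow_add_self (k : ℕ) :
    trace (G.adjMatrix ℤ ^ (k + k)) = ∑ u, ∑ v, (G.adjMatrix ℤ ^ k) u v ^ 2 := by
  have hs : (G.adjMatrix ℤ ^ k)ᵀ = G.adjMatrix ℤ ^ k := by
    rw [transpose_pow, transpose_adjMatrix]
  rw [pow_add]
  refine sum_congr rfl fun u _ => ?_
  rw [diag_apply, mul_apply]
  refine sum_congr rfl fun v _ => ?_
  rw [sq]
  congr 1
  exact congrFun (congrFun hs u) v

variable (G) in
theorem trace_adjMatrix_sq : trace (G.adjMatrix ℤ ^ 2) = ∑ v, (G.degree v : ℤ) := by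
  simp only [trace, diag_apply, sq, adjMatrix_mul_self_apply_self]

variable (G) in
theorem sum_sum_adjMatrix_sq :
    ∑ u, ∑ v, (G.adjMatrix ℤ ^ 2) u v = ∑ v, (G.degree v : ℤ) ^ 2 := by
  simp only [sq, mul_apply]
  rw [← sum_sum_adjMatrix_mul']
  refine sum_congr rfl fun u _ => ?_
  rw [sum_comm]
  simp only [← mul_sum, sum_adjMatrix]

variable (G) in
theorem sum_sum_adjMatrix_cube :
    ∑ u, ∑ v, (G.adjMatrix ℤ ^ 3) u v =
      ∑ u, ∑ v, G.adjMatrix ℤ u v * (G.degree u * G.degree v) := by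
  have h : ∀ u, ∑ v, (G.adjMatrix ℤ ^ 3) u v =
      ∑ b, G.adjMatrix ℤ u b * ∑ c, G.adjMatrix ℤ b c * G.degree c := by
    intro u
    simp only [pow_succ' _ 2, mul_apply (M := G.adjMatrix ℤ)]
    rw [sum_comm]
    simp only [← mul_sum]
    refine sum_congr rfl fun b _ => ?_
    simp only [sq, mul_apply]
    rw [sum_comm]
    simp only [← mul_sum, sum_adjMatrix]
  simp only [h]
  rw [sum_sum_adjMatrix_mul']
  simp only [mul_sum]
  exact sum_congr rfl fun u _ => sum_congr rfl fun v _ => by ring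

theorem IsAcyclic.adjMatrix_sq_apply_sq (hG : G.IsAcyclic) (u v : V) :
    (G.adjMatrix ℤ ^ 2) u v ^ 2 = (G.adjMatrix ℤ ^ 2) u v +
      if u = v then (G.degree u : ℤ) ^ 2 - G.degree u else 0 := by
  split_ifs with huv
  · subst huv
    rw [sq (G.adjMatrix ℤ), adjMatrix_mul_self_apply_self]
    ring
  · have h : (G.adjMatrix ℤ ^ 2) u v = #{b | G.Adj u b ∧ G.Adj b v} := by
      simp [sq, mul_apply, adjMatrix_apply, ← ite_and, and_comm]
    have hle : #{b | G.Adj u b ∧ G.Adj b v} ≤ 1 := by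
      refine card_le_one.2 fun b hb b' hb' => ?_
      simp only [mem_filter, mem_univ, true_and] at hb hb'
      exact hG.eq_of_adj_of_adj huv hb.1 hb.2 hb'.1 hb'.2
    rw [h]
    interval_cases #{b | G.Adj u b ∧ G.Adj b v} <;> simp

theorem IsAcyclic.trace_adjMatrix_pow_four (hG : G.IsAcyclic) :
    trace (G.adjMatrix ℤ ^ 4) = 2 * ∑ v, (G.degree v : ℤ) ^ 2 - ∑ v, (G.degree v : ℤ) := by
  rw [G.trace_adjMatrix_pow_add_self 2]
  simp only [hG.adjMatrix_sq_apply_sq, sum_add_distrib, sum_sum_adjMatrix_sq, sum_ite_eq,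
    mem_univ, if_true, sum_sub_distrib]
  ring

theorem IsAcyclic.adjMatrix_cube_apply (hG : G.IsAcyclic) (a d : V) :
    (G.adjMatrix ℤ ^ 3) a d =
      G.numPathFour a d + G.adjMatrix ℤ a d * (G.degree a + G.degree d - 1) := by
  classical
  have h : (G.adjMatrix ℤ ^ 3) a d =
      ∑ b, ∑ c, G.adjMatrix ℤ a b * (G.adjMatrix ℤ b c * G.adjMatrix ℤ c d) := by
    simp only [pow_succ' _ 2, sq, mul_apply, mul_sum]
  simp only [h, hG.adjMatrix_mul_mul, sum_add_distrib, sum_sub_distrib, natCast_numPathFour,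
    sum_ite_eq', mem_univ, if_true, ← sum_mul, sum_adjMatrix]
  rw [sum_comm (f := fun b c => if b = d then G.adjMatrix ℤ a d * G.adjMatrix ℤ d c else 0),
    sum_comm (f := fun b c => if b = d then if c = a then G.adjMatrix ℤ a d else 0 else 0)]
  simp only [sum_ite_eq', mem_univ, if_true, ← mul_sum, sum_adjMatrix]
  ring

theorem IsAcyclic.adjMatrix_cube_apply_sq (hG : G.IsAcyclic) (a d : V) :
    (G.adjMatrix ℤ ^ 3) a d ^ 2 =
      G.numPathFour a d + G.adjMatrix ℤ a d * (G.degree a + G.degree d - 1) ^ 2 := by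
  rw [hG.adjMatrix_cube_apply]
  by_cases h : G.Adj a d
  · simp [hG.numPathFour_eq_zero_of_adj h, h]
  · have := hG.numPathFour_le_one a d
    interval_cases G.numPathFour a d <;> simp [h]

theorem IsAcyclic.trace_adjMatrix_pow_six (hG : G.IsAcyclic) :
    trace (G.adjMatrix ℤ ^ 6) = 3 * ∑ a, ∑ d, (G.numPathFour a d : ℤ) +
      2 * ∑ v, (G.degree v : ℤ) ^ 3 - ∑ v, (G.degree v : ℤ) := by
  have hcube := G.sum_sum_adjMatrix_cube
  simp only [hG.adjMatrix_cube_apply, sum_add_distrib] at hcube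
  have h₁ : ∑ a, ∑ d, G.adjMatrix ℤ a d * ((G.degree a : ℤ) + G.degree d - 1) =
      2 * ∑ v, (G.degree v : ℤ) ^ 2 - ∑ v, (G.degree v : ℤ) := by
    simp only [mul_sub, mul_add, sum_sub_distrib, sum_add_distrib, sum_sum_adjMatrix_mul,
      sum_sum_adjMatrix_mul', mul_one, sum_adjMatrix, ← sq]
    ring
  have h₂ : ∑ a, ∑ d, G.adjMatrix ℤ a d * ((G.degree a : ℤ) + G.degree d - 1) ^ 2 =
      2 * ∑ v, (G.degree v : ℤ) ^ 3 - 4 * ∑ v, (G.degree v : ℤ) ^ 2 + ∑ v, (G.degree v : ℤ) +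
        2 * ∑ a, ∑ d, G.adjMatrix ℤ a d * ((G.degree a : ℤ) * G.degree d) := by
    have h : ∀ a d, G.adjMatrix ℤ a d * ((G.degree a : ℤ) + G.degree d - 1) ^ 2 =
        G.adjMatrix ℤ a d * ((G.degree a : ℤ) ^ 2 - 2 * G.degree a + 1) +
        G.adjMatrix ℤ a d * ((G.degree d : ℤ) ^ 2 - 2 * G.degree d) +
        2 * (G.adjMatrix ℤ a d * ((G.degree a : ℤ) * G.degree d)) := fun a d => by ring
    simp only [h, sum_add_distrib,
      G.sum_sum_adjMatrix_mul (fun v => (G.degree v : ℤ) ^ 2 - 2 * G.degree v + 1),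
      G.sum_sum_adjMatrix_mul' (fun v => (G.degree v : ℤ) ^ 2 - 2 * G.degree v), ← mul_sum]
    rw [add_left_inj]
    simp only [mul_sum, ← sum_add_distrib, ← sum_sub_distrib]
    exact sum_congr rfl fun v _ => by ring
  rw [G.trace_adjMatrix_pow_add_self 3]
  simp only [hG.adjMatrix_cube_apply_sq, sum_add_distrib, h₂]
  rw [h₁] at hcube
  linarith

end Moments

end SimpleGraph

theorem deg_eq_degree {V : Type*} [Fintype V] (G : SimpleGraph V) [DecidableRel G.Adj] (v : V) :
    deg G v = G.degree v := by
  unfold deg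
  congr!

theorem specMoment_eq_trace {V : Type*} [Fintype V] [DecidableEq V] (G : SimpleGraph V)
    [DecidableRel G.Adj] (k : ℕ) : specMoment G k = Matrix.trace (G.adjMatrix ℤ ^ k) := by
  unfold specMoment
  congr!

theorem stmt18 (n : ℕ) (T₁ T₂ : SimpleGraph (Fin n))
    (h₁ : T₁.IsTree) (h₂ : T₂.IsTree)
    (hdeg : Multiset.map (deg T₁) Finset.univ.val = Multiset.map (deg T₂) Finset.univ.val) :
    (∀ k ≤ 5, specMoment T₁ k = specMoment T₂ k) ∧
    specMoment T₁ 6 - specMoment T₂ 6 = 6 * ((countP4 T₁ : ℤ) - (countP4 T₂ : ℤ)) := by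
  classical
  have hsum : ∀ j : ℕ, ∑ v, (T₁.degree v : ℤ) ^ j = ∑ v, (T₂.degree v : ℤ) ^ j := by
    intro j
    have h := congrArg (fun s => (s.map fun d : ℕ => (d : ℤ) ^ j).sum) hdeg
    simp only [Multiset.map_map, Function.comp_def, deg_eq_degree] at h
    exact h
  have hsum₁ : ∑ v, (T₁.degree v : ℤ) = ∑ v, (T₂.degree v : ℤ) := by simpa using hsum 1
  simp only [specMoment_eq_trace]
  refine ⟨fun k hk => ?_, ?_⟩
  · rcases Nat.even_or_odd k with hev | hodd
    · have hk' : k = 0 ∨ k = 2 ∨ k = 4 := by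
        obtain ⟨m, rfl⟩ := hev
        omega
      rcases hk' with rfl | rfl | rfl
      · simp
      · rw [T₁.trace_adjMatrix_sq, T₂.trace_adjMatrix_sq, hsum₁]
      · rw [h₁.isAcyclic.trace_adjMatrix_pow_four, h₂.isAcyclic.trace_adjMatrix_pow_four,
          hsum 2, hsum₁]
    · rw [h₁.isAcyclic.trace_adjMatrix_pow_of_odd hodd,
        h₂.isAcyclic.trace_adjMatrix_pow_of_odd hodd]
  · rw [h₁.isAcyclic.trace_adjMatrix_pow_six, h₂.isAcyclic.trace_adjMatrix_pow_six,
      ← SimpleGraph.two_mul_countP4, ← SimpleGraph.two_mul_countP4, hsum 3, hsum₁]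
    ring
end

section
/- Let G be a bipartite graph without isolated vertices. Then G is unmixed if and only if there exist a bipartition of G into parts of equal size g with enumerations V₁ = {x₁, …, x_g} and V₂ = {y₁, …, y_g} such that: (a) {x_i, y_i} ∈ E(G) for every i; and (b) whenever {x_i, y_j} ∈ E(G) and {x_j, y_k} ∈ E(G) for three distinct indices i, j, k, also {x_i, y_k} ∈ E(G). -/
/-- A vertex cover: a set of vertices meeting every edge. -/
def IsVertexCover {V : Type*} (G : SimpleGraph V) (C : Set V) : Prop :=
  ∀ ⦃u v⦄, G.Adj u v → u ∈ C ∨ v ∈ C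

/-- A minimal vertex cover: a vertex cover minimal under inclusion. -/
def IsMinimalVertexCover {V : Type*} (G : SimpleGraph V) (C : Set V) : Prop :=
  IsVertexCover G C ∧ ∀ C' ⊆ C, IsVertexCover G C' → C' = C

/-- A graph is unmixed if all its minimal vertex covers have the same cardinality. -/
def Unmixed {V : Type*} (G : SimpleGraph V) : Prop :=
  ∀ C₁ C₂ : Set V, IsMinimalVertexCover G C₁ → IsMinimalVertexCover G C₂ →
    C₁.ncard = C₂.ncard

/-- A graph is bipartite if its vertices can be split into two independent sets. -/
def IsBipartite {V : Type*} (G : SimpleGraph V) : Prop :=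
  ∃ A : Set V, ∀ ⦃u v⦄, G.Adj u v → (u ∈ A ↔ v ∉ A)

/-- A vertex cover is minimal if each of its vertices has a neighbour outside it. -/
theorem IsMinimalVertexCover.of_forall_exists {V : Type*} {G : SimpleGraph V} {C : Set V}
    (hC : IsVertexCover G C) (h : ∀ v ∈ C, ∃ u, G.Adj v u ∧ u ∉ C) :
    IsMinimalVertexCover G C := by
  refine ⟨hC, fun C' hsub hC' => hsub.antisymm fun v hv => ?_⟩
  obtain ⟨u, hvu, hu⟩ := h v hv
  exact (hC' hvu).resolve_right fun hu' => hu (hsub hu')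

theorem IsMinimalVertexCover.exists_adj_notMem {V : Type*} {G : SimpleGraph V} {C : Set V}
    (hC : IsMinimalVertexCover G C) {v : V} (hv : v ∈ C) : ∃ u, G.Adj v u ∧ u ∉ C := by
  by_contra! h
  have hcover : IsVertexCover G (C \ {v}) := by
    intro a b hab
    by_cases ha : a = v
    · subst ha
      exact Or.inr ⟨h b hab, hab.ne'⟩
    by_cases hb : b = v
    · subst hb
      exact Or.inl ⟨h a hab.symm, ha⟩
    · exact (hC.1 hab).imp (⟨·, ha⟩) (⟨·, hb⟩)
  have hmem : v ∈ C \ {v} := (hC.2 _ Set.sdiff_subset hcover).symm ▸ hv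
  exact hmem.2 rfl

theorem IsVertexCover.exists_isMinimalVertexCover_subset {V : Type*} [Finite V]
    {G : SimpleGraph V} {C : Set V} (hC : IsVertexCover G C) :
    ∃ D ⊆ C, IsMinimalVertexCover G D := by
  obtain ⟨D, hDC, hD⟩ := exists_minimal_le_of_wellFoundedLT (IsVertexCover G) C hC
  exact ⟨D, hDC, hD.prop, fun C' hsub hC' => hD.eq_of_subset hC' hsub⟩

/-- A set meeting every pair of a partition into `g` pairs has `g` elements exactly if it contains
no pair. -/
theorem ncard_eq_iff_of_pairs {V : Type*} [Finite V] {g : ℕ} {x y : Fin g → V}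
    (hx : Function.Injective x) (hy : Function.Injective y) (hxy : ∀ i j, x i ≠ y j)
    (hall : ∀ v, (∃ i, v = x i) ∨ (∃ i, v = y i)) {C : Set V}
    (hC : ∀ i, x i ∈ C ∨ y i ∈ C) :
    C.ncard = g ↔ ∀ i, ¬(x i ∈ C ∧ y i ∈ C) := by
  classical
  let f : Fin g → V := fun i => if x i ∈ C then x i else y i
  have hf : Function.Injective f := by
    intro i j hij
    simp only [f] at hij
    split_ifs at hij
    · exact hx hij
    · exact absurd hij (hxy i j)
    · exact absurd hij.symm (hxy j i)
    · exact hy hij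
  have hsub : Set.range f ⊆ C := by
    rintro _ ⟨i, rfl⟩
    have := hC i
    simp only [f]
    split_ifs <;> tauto
  have hcard : (Set.range f).ncard = g := by
    rw [Set.ncard_range_of_injective hf, Nat.card_fin]
  constructor
  · rintro h i ⟨hxi, hyi⟩
    rw [← Set.eq_of_subset_of_ncard_le hsub (by omega) C.toFinite] at hyi
    obtain ⟨j, hj⟩ := hyi
    simp only [f] at hj
    split_ifs at hj with hxj
    · exact hxy j i hj
    · exact hxj (hy hj ▸ hxi)
  · intro h
    rw [← hcard]
    congr 1
    refine Set.Subset.antisymm (fun v hv => ?_) hsub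
    obtain ⟨i, rfl⟩ | ⟨i, rfl⟩ := hall v
    · exact ⟨i, if_pos hv⟩
    · exact ⟨i, if_neg fun hxi => h i ⟨hxi, hv⟩⟩

/-- In an unmixed graph a minimal vertex cover has minimum cardinality among all vertex covers. -/
theorem Unmixed.ncard_le {V : Type*} [Finite V] {G : SimpleGraph V} (hG : Unmixed G)
    {C K : Set V} (hC : IsMinimalVertexCover G C) (hK : IsVertexCover G K) :
    C.ncard ≤ K.ncard := by
  obtain ⟨D, hDK, hD⟩ := hK.exists_isMinimalVertexCover_subset
  exact (hG C D hC hD).trans_le (Set.ncard_le_ncard hDK K.toFinite)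

/-- Hall's condition: an injective enumeration of an independent minimal vertex cover of an unmixed
graph can be matched along edges. -/
theorem Unmixed.exists_matching {V : Type*} [Finite V] {G : SimpleGraph V} (hG : Unmixed G)
    {ι : Type*} [Finite ι] {x : ι → V} (hx : Function.Injective x)
    (hmin : IsMinimalVertexCover G (Set.range x)) :
    ∃ y : ι → V, Function.Injective y ∧ ∀ i, G.Adj (x i) (y i) := by
  classical
  have := Fintype.ofFinite V
  have := Fintype.ofFinite ι
  let t : ι → Finset V := fun i => Finset.univ.filter (G.Adj (x i))
  have hall : ∀ s : Finset ι, s.card ≤ (s.biUnion t).card := by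
    intro s
    have hcover : IsVertexCover G (((sᶜ.image x ∪ s.biUnion t : Finset V)) : Set V) := by
      have key : ∀ i v, G.Adj (x i) v →
          x i ∈ sᶜ.image x ∪ s.biUnion t ∨ v ∈ sᶜ.image x ∪ s.biUnion t := by
        intro i v hv
        by_cases hi : i ∈ s
        · refine Or.inr (Finset.mem_union_right _ (Finset.mem_biUnion.2 ⟨i, hi, ?_⟩))
          simpa [t] using hv
        · exact Or.inl (Finset.mem_union_left _
            (Finset.mem_image_of_mem x (Finset.mem_compl.2 hi)))
      intro u v huv
      simp only [Finset.mem_coe]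
      obtain ⟨i, rfl⟩ | ⟨i, rfl⟩ := hmin.1 huv
      · exact key i v huv
      · exact (key i u huv.symm).symm
    have h1 := hG.ncard_le hmin hcover
    rw [Set.ncard_range_of_injective hx, Set.ncard_coe_finset, Nat.card_eq_fintype_card] at h1
    have h2 := Finset.card_union_le (sᶜ.image x) (s.biUnion t)
    have h3 : (sᶜ.image x).card ≤ sᶜ.card := Finset.card_image_le
    have h4 := Finset.card_add_card_compl s
    omega
  obtain ⟨y, hy, hmem⟩ := (Finset.all_card_le_biUnion_card_iff_exists_injective t).1 hall
  exact ⟨y, hy, fun i => by simpa [t] using hmem i⟩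

theorem stmt19 (V : Type) [Fintype V] (G : SimpleGraph V)
    (hbip : IsBipartite G) (hiso : ∀ v : V, ∃ u, G.Adj v u) :
    Unmixed G ↔
      ∃ (g : ℕ) (x y : Fin g → V),
        Function.Injective x ∧ Function.Injective y ∧
        (∀ i j : Fin g, x i ≠ y j) ∧
        (∀ v : V, (∃ i, v = x i) ∨ (∃ i, v = y i)) ∧
        (∀ i j : Fin g, ¬G.Adj (x i) (x j)) ∧
        (∀ i j : Fin g, ¬G.Adj (y i) (y j)) ∧
        (∀ i : Fin g, G.Adj (x i) (y i)) ∧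
        (∀ i j k : Fin g, i ≠ j → j ≠ k → i ≠ k →
          G.Adj (x i) (y j) → G.Adj (x j) (y k) → G.Adj (x i) (y k)) := by
  constructor
  · intro hG
    obtain ⟨A, hA⟩ := hbip
    have hminA : IsMinimalVertexCover G A := by
      refine .of_forall_exists (fun u v huv => ?_) fun v hv => ?_
      · have := hA huv
        tauto
      · obtain ⟨u, hu⟩ := hiso v
        exact ⟨u, hu, (hA hu).1 hv⟩
    have hminAc : IsMinimalVertexCover G Aᶜ := by
      refine .of_forall_exists (fun u v huv => ?_) fun v hv => ?_
      · have := hA huv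
        simp only [Set.mem_compl_iff]
        tauto
      · obtain ⟨u, hu⟩ := hiso v
        exact ⟨u, hu, not_not.2 ((hA hu.symm).2 hv)⟩
    let e : Fin A.ncard ≃ A := (Finite.equivFin A).symm
    let x : Fin A.ncard → V := fun i => e i
    have hx : Function.Injective x := Subtype.val_injective.comp e.injective
    have hrangex : Set.range x = A :=
      (e.surjective.range_comp Subtype.val).trans Subtype.range_coe
    obtain ⟨y, hy, hadj⟩ := hG.exists_matching hx (by rwa [hrangex])
    have hxA : ∀ i, x i ∈ A := fun i => (e i).2
    have hyA : ∀ i, y i ∉ A := fun i => (hA (hadj i)).1 (hxA i)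
    have hrangey : Set.range y = Aᶜ := by
      refine Set.eq_of_subset_of_ncard_le ?_ ?_ (Set.toFinite _)
      · rintro _ ⟨i, rfl⟩
        exact hyA i
      · rw [Set.ncard_range_of_injective hy, Nat.card_fin, hG _ _ hminAc hminA]
    have hxy : ∀ i j, x i ≠ y j := fun i j h => hyA j (h ▸ hxA i)
    have hall : ∀ v, (∃ i, v = x i) ∨ (∃ i, v = y i) := by
      intro v
      by_cases hv : v ∈ A
      · obtain ⟨i, hi⟩ := hrangex.symm ▸ hv
        exact Or.inl ⟨i, hi.symm⟩
      · obtain ⟨i, hi⟩ : v ∈ Set.range y := hrangey.symm ▸ hv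
        exact Or.inr ⟨i, hi.symm⟩
    refine ⟨A.ncard, x, y, hx, hy, hxy, hall, fun i j h => (hA h).1 (hxA i) (hxA j),
      fun i j h => hyA i ((hA h).2 (hyA j)), hadj, fun i j k _ _ _ hij hjk => ?_⟩
    by_contra hik
    have hcover : IsVertexCover G ({x i, y k}ᶜ : Set V) := by
      intro u v huv
      by_contra! h
      simp only [Set.mem_compl_iff, Set.mem_insert_iff, Set.mem_singleton_iff, not_not] at h
      obtain ⟨rfl | rfl, rfl | rfl⟩ := h
      · exact huv.ne rfl
      · exact hik huv
      · exact hik huv.symm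
      · exact huv.ne rfl
    obtain ⟨D, hDsub, hD⟩ := hcover.exists_isMinimalVertexCover_subset
    have hxi : x i ∉ D := fun h => hDsub h (by simp)
    have hyk : y k ∉ D := fun h => hDsub h (by simp)
    exact (ncard_eq_iff_of_pairs hx hy hxy hall fun l => hD.1 (hadj l)).1 (hG D A hD hminA) j
      ⟨(hD.1 hjk).resolve_right hyk, (hD.1 hij).resolve_left hxi⟩
  · rintro ⟨g, x, y, hx, hy, hxy, hall, hxx, hyy, hadj, htrans⟩
    have hcard : ∀ C, IsMinimalVertexCover G C → C.ncard = g := by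
      intro C hC
      refine (ncard_eq_iff_of_pairs hx hy hxy hall fun l => hC.1 (hadj l)).2 ?_
      rintro i ⟨hxi, hyi⟩
      obtain ⟨u, hu, huC⟩ := hC.exists_adj_notMem hxi
      obtain ⟨w, hw, hwC⟩ := hC.exists_adj_notMem hyi
      obtain ⟨j, rfl⟩ | ⟨j, rfl⟩ := hall u
      · exact hxx i j hu
      obtain ⟨k, rfl⟩ | ⟨k, rfl⟩ := hall w
      · have hki : k ≠ i := by
          rintro rfl
          exact hwC hxi
        have hij : i ≠ j := by
          rintro rfl
          exact huC hyi
        have hkj : G.Adj (x k) (y j) := by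
          by_cases h : k = j
          · exact h ▸ hadj k
          · exact htrans k i j hki hij h hw.symm hu
        exact (hC.1 hkj).elim hwC huC
      · exact hyy i k hw
    intro C₁ C₂ h₁ h₂
    rw [hcard C₁ h₁, hcard C₂ h₂]
end
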